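/- For every Young diagram λ and every nonnegative integer m, the number of X-diagrams of shape λ with no zero-column and exactly m unrestricted rows equals the number of permutation tableaux of shape λ with exactly m unrestricted rows. -/

import Mathlib

/-- A diagram of shape `S`: a 0/1 filling (`Bool`-valued), required to be
`false` outside the cells of `S`. -/
def IsFilling (S : Finset (ℕ × ℕ)) (T : ℕ × ℕ → Bool) : Prop :=
  ∀ c, c ∉ S → T c = false

/-- `T` avoids the 2×2 pattern `[[a,b],[c,d]]` (top-left `a`, top-right `b`,
bottom-left `c`, bottom-right `d`) within the shape `S`. -/
def Avoids (S : Finset (ℕ × ℕ)) (T : ℕ × ℕ → Bool) (a b c d : Bool) : Prop :=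
  ¬ ∃ i i' j j' : ℕ, i < i' ∧ j < j' ∧
    (i, j) ∈ S ∧ (i, j') ∈ S ∧ (i', j) ∈ S ∧ (i', j') ∈ S ∧
    T (i, j) = a ∧ T (i, j') = b ∧ T (i', j) = c ∧ T (i', j') = d

/-- An X-diagram avoids the patterns `[[1,0],[0,1]]` and `[[0,1],[1,0]]`. -/
def IsXDiagram (S : Finset (ℕ × ℕ)) (T : ℕ × ℕ → Bool) : Prop :=
  IsFilling S T ∧ Avoids S T true false false true ∧ Avoids S T false true true false

/-- A Le-diagram avoids the patterns `[[1,1],[1,0]]` and `[[0,1],[1,0]]`. -/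
def IsLeDiagram (S : Finset (ℕ × ℕ)) (T : ℕ × ℕ → Bool) : Prop :=
  IsFilling S T ∧ Avoids S T true true true false ∧ Avoids S T false true true false

/-- Row `i` of the diagram is filled with 0s. -/
def ZeroRow (S : Finset (ℕ × ℕ)) (T : ℕ × ℕ → Bool) (i : ℕ) : Prop :=
  ∀ j, (i, j) ∈ S → T (i, j) = false

/-- Column `j` of the diagram is filled with 0s. -/
def ZeroCol (S : Finset (ℕ × ℕ)) (T : ℕ × ℕ → Bool) (j : ℕ) : Prop :=
  ∀ i, (i, j) ∈ S → T (i, j) = false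

/-- No column of the shape is a zero-column. -/
def NoZeroCol (S : Finset (ℕ × ℕ)) (T : ℕ × ℕ → Bool) : Prop :=
  ∀ j, (∃ i, (i, j) ∈ S) → ¬ ZeroCol S T j

/-- Row `i` is restricted: it contains a 0 having a 1 above it in the same
column. -/
def RestrictedRow (S : Finset (ℕ × ℕ)) (T : ℕ × ℕ → Bool) (i : ℕ) : Prop :=
  ∃ j, (i, j) ∈ S ∧ T (i, j) = false ∧ ∃ i', i' < i ∧ (i', j) ∈ S ∧ T (i', j) = true

def Rst (S : Finset (ℕ × ℕ)) (T : ℕ × ℕ → Bool) (i : ℕ) : Prop :=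
  ∃ j, (i, j) ∈ S ∧ T (i, j) = false ∧ ∃ i', i' < i ∧ T (i', j) = true

def Fil (S : Finset (ℕ × ℕ)) (T : ℕ × ℕ → Bool) : Prop :=
  ∀ a b, T (a, b) = true → (a, b) ∈ S

def XA (S : Finset (ℕ × ℕ)) (T : ℕ × ℕ → Bool) : Prop :=
  Fil S T ∧ ∀ a b c d, (a, d) ∈ S → (b, c) ∈ S → T (a, c) = true → T (b, d) = true →
    T (a, d) = true ∨ T (b, c) = true

def LA (S : Finset (ℕ × ℕ)) (T : ℕ × ℕ → Bool) : Prop :=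
  Fil S T ∧ ∀ a b c d, a < b → c < d → (b, d) ∈ S → T (a, d) = true → T (b, c) = true →
    T (b, d) = true

open Classical in
noncomputable def unr (I : Finset ℕ) (S : Finset (ℕ × ℕ)) (T : ℕ × ℕ → Bool) : Finset ℕ :=
  I.filter (fun i => ¬ Rst S T i)

def AA (P : Finset (ℕ × ℕ) → (ℕ × ℕ → Bool) → Prop) (I J : Finset ℕ) (S : Finset (ℕ × ℕ))
    (m : ℕ) : Set (ℕ × ℕ → Bool) :=
  {T | P S T ∧ (∀ j ∈ J, ∃ i, T (i, j) = true) ∧ (unr I S T).card = m}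

structure Shp (I J : Finset ℕ) (S : Finset (ℕ × ℕ)) : Prop where
  sub : ∀ i j, (i, j) ∈ S → i ∈ I ∧ j ∈ J
  dn : ∀ i i' j j', i ∈ I → j ∈ J → i ≤ i' → j ≤ j' → (i', j') ∈ S → (i, j) ∈ S

structure Cor (I J : Finset ℕ) (S : Finset (ℕ × ℕ)) (r c : ℕ) : Prop extends Shp I J S where
  mem : (r, c) ∈ S
  bot : ∀ i j, (i, j) ∈ S → i ≤ r
  rt : ∀ j, (r, j) ∈ S → j ≤ c

def zr (r : ℕ) (T : ℕ × ℕ → Bool) : ℕ × ℕ → Bool := fun p => if p.1 = r then false else T p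
def zc (c : ℕ) (T : ℕ × ℕ → Bool) : ℕ × ℕ → Bool := fun p => if p.2 = c then false else T p
def st (r c : ℕ) (v : Bool) (T : ℕ × ℕ → Bool) : ℕ × ℕ → Bool :=
  fun p => if p.1 = r ∧ p.2 = c then v else T p

def Se (S : Finset (ℕ × ℕ)) (r c : ℕ) : Finset (ℕ × ℕ) := S.filter (fun p => ¬ (p.1 = r ∧ p.2 = c))
def Sr (S : Finset (ℕ × ℕ)) (r : ℕ) : Finset (ℕ × ℕ) := S.filter (fun p => p.1 ≠ r)
def Sc (S : Finset (ℕ × ℕ)) (c : ℕ) : Finset (ℕ × ℕ) := S.filter (fun p => p.2 ≠ c)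

lemma mem_Se {S r c a b} : (a, b) ∈ Se S r c ↔ (a, b) ∈ S ∧ ¬ (a = r ∧ b = c) := by simp [Se]
lemma mem_Sr {S r a b} : (a, b) ∈ Sr S r ↔ (a, b) ∈ S ∧ a ≠ r := by simp [Sr]
lemma mem_Sc {S c a b} : (a, b) ∈ Sc S c ↔ (a, b) ∈ S ∧ b ≠ c := by simp [Sc]
lemma zr_ap {r T a b} : zr r T (a, b) = if a = r then false else T (a, b) := rfl
lemma zc_ap {c T a b} : zc c T (a, b) = if b = c then false else T (a, b) := rfl
lemma st_ap {r c v T a b} : st r c v T (a, b) = if a = r ∧ b = c then v else T (a, b) := rfl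

lemma AA_finite {P} (hP : ∀ S T, P S T → Fil S T) (I J S m) : (AA P I J S m).Finite := by
  have h2 : AA P I J S m ⊆ (fun (U : Finset (ℕ × ℕ)) => fun p => decide (p ∈ U)) '' (S.powerset : Set (Finset (ℕ × ℕ))) := by
    intro T hT
    refine ⟨S.filter (fun p => T p = true), ?_, ?_⟩
    · simp only [Finset.coe_powerset, Set.mem_preimage, Set.mem_powerset_iff, Finset.coe_subset]; exact Finset.filter_subset _ _
    funext ⟨a, b⟩
    have := hP S T hT.1 a b
    cases h : T (a, b) <;> simp_all
  exact (Set.Finite.image _ (Finset.finite_toSet _)).subset h2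

lemma unr_congr {I S S' T T'} (h : ∀ i ∈ I, Rst S T i ↔ Rst S' T' i) : unr I S T = unr I S' T' := by
  unfold unr
  ext i
  simp only [Finset.mem_filter]
  constructor
  · rintro ⟨a, b⟩; exact ⟨a, by rwa [← h i a]⟩
  · rintro ⟨a, b⟩; exact ⟨a, by rwa [h i a]⟩

lemma unr_erase {I S S' T T'} {r : ℕ} (hr : Rst S T r)
    (h : ∀ i ∈ I, i ≠ r → (Rst S T i ↔ Rst S' T' i)) : unr I S T = unr (I.erase r) S' T' := by
  unfold unr
  ext i
  simp only [Finset.mem_filter, Finset.mem_erase]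
  by_cases hi : i = r
  · subst hi; simp [hr]
  · constructor
    · rintro ⟨a, b⟩; exact ⟨⟨hi, a⟩, by rwa [← h i a hi]⟩
    · rintro ⟨⟨_, a⟩, b⟩; exact ⟨a, by rwa [h i a hi]⟩

lemma ncard_bij {s t : Set (ℕ × ℕ → Bool)} (f g : (ℕ × ℕ → Bool) → (ℕ × ℕ → Bool))
    (hf : ∀ x ∈ s, f x ∈ t ∧ g (f x) = x) (hg : ∀ y ∈ t, g y ∈ s ∧ f (g y) = y) :
    s.ncard = t.ncard := by
  have : Set.BijOn f s t := Set.InvOn.bijOn (f' := g)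
    ⟨fun x hx => (hf x hx).2, fun y hy => (hg y hy).2⟩ (fun x hx => (hf x hx).1) (fun x hx => (hg x hx).1)
  rw [← this.image_eq, this.injOn.ncard_image]

lemma ncard_split {s : Set (ℕ × ℕ → Bool)} (hs : s.Finite) (q : (ℕ × ℕ → Bool) → Prop) :
    s.ncard = {T | T ∈ s ∧ q T}.ncard + {T | T ∈ s ∧ ¬ q T}.ncard := by
  rw [← Set.ncard_inter_add_ncard_sdiff_eq_ncard s {T | q T} hs]
  rfl

section
variable {I J : Finset ℕ} {S : Finset (ℕ × ℕ)} {r c : ℕ}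

-- restrictedness lemmas
lemma rst_st {T} (h : Cor I J S r c) : ∀ i, Rst S (st r c true T) i ↔ Rst (Se S r c) T i := by
  intro i
  have := h.bot
  simp only [Rst, mem_Se, st_ap]
  grind

lemma rst_r {T} (h : Cor I J S r c) (i) (hi : i ≠ r) : Rst (Sr S r) (zr r T) i ↔ Rst S T i := by
  have := h.bot
  simp only [Rst, mem_Sr, zr_ap]
  grind

lemma rst_c {T T' : ℕ × ℕ → Bool} {i : ℕ} (h : ∀ i j, j ≠ c → T' (i, j) = T (i, j))
    (hc : ∀ i', i' < i → (i, c) ∈ S → T (i, c) = false → T (i', c) = true → Rst (Sc S c) T' i) :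
    Rst S T i ↔ Rst (Sc S c) T' i := by
  constructor
  · rintro ⟨j, h1, h2, i', h3, h4⟩
    by_cases hj : j = c
    · subst hj; exact hc i' h3 h1 h2 h4
    · exact ⟨j, mem_Sc.2 ⟨h1, hj⟩, by rw [h _ _ hj]; exact h2, i', h3, by rw [h _ _ hj]; exact h4⟩
  · rintro ⟨j, h1, h2, i', h3, h4⟩
    obtain ⟨h1, hj⟩ := mem_Sc.1 h1
    exact ⟨j, h1, by rw [← h _ _ hj]; exact h2, i', h3, by rw [← h _ _ hj]; exact h4⟩

-- Le
lemma LA_fil : ∀ S T, LA S T → Fil S T := fun _ _ h => h.1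
lemma XA_fil : ∀ S T, XA S T → Fil S T := fun _ _ h => h.1

/-- column c (except r) is zero -/
def Cz (r c : ℕ) (T : ℕ × ℕ → Bool) : Prop := ∀ i, i ≠ r → T (i, c) = false

lemma le1 (h : Cor I J S r c) (m) :
   {T | T ∈ AA LA I J S m ∧ (T (r,c) = true ∧ ¬ Cz r c T)}.ncard = (AA LA I J (Se S r c) m).ncard := by
  obtain ⟨⟨hsub, hdn⟩, hmem, hbot, hrt⟩ := h
  have h : Cor I J S r c := ⟨⟨hsub, hdn⟩, hmem, hbot, hrt⟩
  have hst : ∀ T, T (r, c) = true → st r c true (st r c false T) = T := by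
    intro T h; funext ⟨a, b⟩; simp only [st_ap]; grind
  have hst' : ∀ T, T (r, c) = false → st r c false (st r c true T) = T := by
    intro T h; funext ⟨a, b⟩; simp only [st_ap]; grind
  apply ncard_bij (st r c false) (st r c true)
  · rintro T ⟨⟨⟨hF, hL⟩, hN, hu⟩, ht, hC⟩
    refine ⟨⟨⟨?_, ?_⟩, ?_, ?_⟩, hst T ht⟩
    · intro a b; simp only [st_ap, mem_Se]; grind [Fil]
    · intro a b x y; simp only [st_ap, mem_Se]; grind
    · intro j hj; simp only [st_ap]; simp only [Cz] at hC; grind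
    · rw [← hu]; congr 1; apply unr_congr; intro i _; rw [← rst_st h, hst T ht]
  · rintro T ⟨⟨hF, hL⟩, hN, hu⟩
    have hrc : T (r, c) = false := by
      have := hF r c; simp only [mem_Se] at this; grind
    simp only [Fil, mem_Se] at hF hL
    refine ⟨⟨⟨⟨?_, ?_⟩, ?_, ?_⟩, ?_, ?_⟩, hst' T hrc⟩
    · intro a b; simp only [st_ap]; grind
    · intro a b x y; simp only [st_ap]; grind
    · intro j hj; obtain ⟨i, hi⟩ := hN j hj; refine ⟨i, ?_⟩; simp only [st_ap]; grind
    · rw [← hu]; congr 1; apply unr_congr; intro i _; rw [rst_st h]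
    · simp [st_ap]
    · obtain ⟨i, hi⟩ := hN c (hsub _ _ hmem).2
      simp only [Cz, st_ap]; grind

lemma le2 (h : Cor I J S r c) (m) :
   {T | T ∈ AA LA I J S m ∧ (T (r,c) = true ∧ Cz r c T)}.ncard = (AA LA I (J.erase c) (Sc S c) m).ncard := by
  obtain ⟨⟨hsub, hdn⟩, hmem, hbot, hrt⟩ := h
  have h : Cor I J S r c := ⟨⟨hsub, hdn⟩, hmem, hbot, hrt⟩
  apply ncard_bij (zc c) (st r c true)
  · rintro T ⟨⟨⟨hF, hL⟩, hN, hu⟩, ht, hC⟩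
    simp only [Cz] at hC
    refine ⟨⟨⟨?_, ?_⟩, ?_, ?_⟩, ?_⟩
    · intro a b; simp only [zc_ap, mem_Sc]; grind [Fil]
    · intro a b x y; simp only [zc_ap, mem_Sc]; grind
    · intro j hj; simp only [zc_ap]; grind
    · rw [← hu]; congr 1; apply unr_congr; intro i _; symm; apply rst_c
      · intro i j hj; simp [zc_ap, hj]
      · intro i' h1 h2 h3 h4; have := hbot _ _ h2; grind
    · funext ⟨a, b⟩; simp only [st_ap, zc_ap]; grind
  · rintro T ⟨⟨hF, hL⟩, hN, hu⟩
    simp only [Fil, mem_Sc] at hF hL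
    have hrc : ∀ i, T (i, c) = false := by grind
    refine ⟨⟨⟨⟨?_, ?_⟩, ?_, ?_⟩, ?_, ?_⟩, ?_⟩
    · intro a b; simp only [st_ap]; grind
    · intro a b x y; simp only [st_ap]; grind
    · intro j hj; simp only [st_ap]; by_cases hjc : j = c
      · exact ⟨r, by simp [hjc]⟩
      · obtain ⟨i, hi⟩ := hN j (by grind)
        exact ⟨i, by grind⟩
    · rw [← hu]; congr 1; apply unr_congr; intro i _; apply rst_c
      · intro i j hj; simp [st_ap, hj]
      · intro i' h1 h2 h3 h4; have := hbot _ _ h2; simp only [st_ap] at h4; grind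
    · simp [st_ap]
    · simp only [Cz, st_ap]; grind
    · funext ⟨a, b⟩; simp only [st_ap, zc_ap]; grind

lemma le3 (h : Cor I J S r c) (m) :
   {T | T ∈ AA LA I J S m ∧ ¬ (T (r,c) = true)}.ncard = (AA LA (I.erase r) J (Sr S r) m).ncard := by
  obtain ⟨⟨hsub, hdn⟩, hmem, hbot, hrt⟩ := h
  have h : Cor I J S r c := ⟨⟨hsub, hdn⟩, hmem, hbot, hrt⟩
  apply ncard_bij id id
  · rintro T ⟨⟨⟨hF, hL⟩, hN, hu⟩, ht⟩
    simp only [Fil] at hF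
    obtain ⟨i, hi⟩ := hN c (hsub _ _ hmem).2
    have hR : ∀ j, T (r, j) = false := by
      intro j; by_contra hj
      have := hF r j; have := hF i c; have := hL i r j c; grind
    have hz : zr r T = T := by funext ⟨a, b⟩; simp only [zr_ap]; grind
    refine ⟨⟨⟨?_, ?_⟩, ?_, ?_⟩, rfl⟩
    · intro a b; simp only [id, mem_Sr]; grind
    · intro a b x y; simp only [id, mem_Sr]; grind
    · exact hN
    · rw [← hu]; congr 1; symm; apply unr_erase
      · have := hF i c; have := hbot i c; exact ⟨c, hmem, by grind, i, by grind, hi⟩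
      · intro i _ hi; simp only [id]; rw [← rst_r h i hi, hz]
  · rintro T ⟨⟨hF, hL⟩, hN, hu⟩
    simp only [Fil, mem_Sr] at hF hL
    have hR : ∀ i, T (r, i) = false := by grind
    have hz : zr r T = T := by funext ⟨a, b⟩; simp only [zr_ap]; grind
    obtain ⟨i, hi⟩ := hN c (hsub _ _ hmem).2
    refine ⟨⟨⟨⟨?_, ?_⟩, ?_, ?_⟩, ?_⟩, rfl⟩
    · intro a b; simp only [id]; grind
    · intro a b x y; simp only [id]; grind
    · exact hN
    · rw [← hu]; congr 1; apply unr_erase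
      · have := hF i c; have := hbot i c; exact ⟨c, hmem, by first | grind | (simp only [id]; grind), i, by grind, hi⟩
      · intro i _ hi; simp only [id]; rw [← rst_r h i hi, hz]
    · simp [hR]

lemma le_rec (h : Cor I J S r c) (m) : (AA LA I J S m).ncard =
    (AA LA I J (Se S r c) m).ncard + (AA LA I (J.erase c) (Sc S c) m).ncard
      + (AA LA (I.erase r) J (Sr S r) m).ncard := by
  have hfin := AA_finite LA_fil I J S m
  rw [ncard_split hfin (fun T => T (r,c) = true), le3 h, ← le1 h, ← le2 h,
    ncard_split (hfin.subset (fun T hT => hT.1)) (fun T => ¬ Cz r c T)]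
  simp [and_assoc]

/-- setting the corner to one is not allowed -/
def Bad (S : Finset (ℕ × ℕ)) (r c : ℕ) (T : ℕ × ℕ → Bool) : Prop :=
  ∃ i j, i ≠ r ∧ j ≠ c ∧ (i, c) ∈ S ∧ (r, j) ∈ S ∧ T (i, j) = true ∧ T (i, c) = false ∧ T (r, j) = false

def CaA (S : Finset (ℕ × ℕ)) (r c : ℕ) (T : ℕ × ℕ → Bool) : Prop :=
  ∀ j, j ≠ c → (r, j) ∈ S → T (r, j) = false → ∃ i, T (i, c) = true ∧ T (i, j) = false

open Classical in
noncomputable def fX (S : Finset (ℕ × ℕ)) (r c : ℕ) (T : ℕ × ℕ → Bool) : ℕ × ℕ → Bool :=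
  if Bad S r c T then T else st r c true T

lemma bad_st {v T} : Bad S r c (st r c v T) ↔ Bad S r c T := by
  simp only [Bad, st_ap]; grind

lemma x1 (h : Cor I J S r c) (m) :
   {T | T ∈ AA XA I J S m ∧ ((T (r,c) = true ∧ ¬ Cz r c T) ∨ (T (r, c) = false ∧ Bad S r c T))}.ncard
     = (AA XA I J (Se S r c) m).ncard := by
  obtain ⟨⟨hsub, hdn⟩, hmem, hbot, hrt⟩ := h
  have h : Cor I J S r c := ⟨⟨hsub, hdn⟩, hmem, hbot, hrt⟩
  have hst : ∀ T, T (r, c) = true → st r c true (st r c false T) = T := by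
    intro T h; funext ⟨a, b⟩; simp only [st_ap]; grind
  have hst' : ∀ T, T (r, c) = false → st r c false (st r c true T) = T := by
    intro T h; funext ⟨a, b⟩; simp only [st_ap]; grind
  have hst'' : ∀ T, T (r, c) = false → st r c false T = T := by
    intro T h; funext ⟨a, b⟩; simp only [st_ap]; grind
  have hbadr : ∀ T, T (r, c) = false → Fil S T → Bad S r c T → ∀ i, Rst S T i ↔ Rst (Se S r c) T i := by
    intro T h1 h2 h3 i
    obtain ⟨i', j', h4, h5, h6, h7, h8, h9, h10⟩ := h3
    by_cases hi : i = r
    · subst hi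
      have a1 : Rst S T i := ⟨j', h7, h10, i', by grind, h8⟩
      have a2 : Rst (Se S i c) T i := ⟨j', by simp [mem_Se]; grind, h10, i', by grind, h8⟩
      simp [a1, a2]
    · simp only [Rst, mem_Se]; grind
  apply ncard_bij (st r c false) (fX S r c)
  · rintro T ⟨⟨⟨hF, hL⟩, hN, hu⟩, hor⟩
    have hF' := hF
    simp only [Fil] at hF
    refine ⟨⟨⟨?_, ?_⟩, ?_, ?_⟩, ?_⟩
    · intro a b; simp only [st_ap, mem_Se]; grind [Fil]
    · intro a b x y; simp only [st_ap, mem_Se]; grind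
    · intro j hj; simp only [st_ap]; simp only [Cz] at hor; grind
    · rw [← hu]; congr 1; apply unr_congr; intro i _
      rcases hor with ⟨ht, _⟩ | ⟨ht, hb⟩
      · rw [← rst_st h, hst T ht]
      · rw [hst'' T ht, hbadr T ht hF' hb]
    · rcases hor with ⟨ht, _⟩ | ⟨ht, hb⟩
      · have : ¬ Bad S r c T := by
          rintro ⟨i', j', h4, h5, h6, h7, h8, h9, h10⟩
          have := hL r i' c j' h7 h6 ht h8
          grind
        rw [fX, if_neg (by rwa [bad_st]), hst T ht]
      · rw [hst'' T ht, fX, if_pos hb]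
  · rintro T ⟨⟨hF, hL⟩, hN, hu⟩
    have hrc : T (r, c) = false := by
      have := hF r c; simp only [mem_Se] at this; grind
    simp only [Fil, mem_Se] at hF hL
    have hFS : Fil S T := fun a b h => (hF a b h).1
    by_cases hb : Bad S r c T
    · rw [fX, if_pos hb]
      refine ⟨⟨⟨⟨hFS, ?_⟩, hN, ?_⟩, Or.inr ⟨hrc, hb⟩⟩, hst'' T hrc⟩
      · have key : ∀ i j, T (i, c) = true → T (r, j) = true → T (i, j) = true := by
          intro i j h1 h2
          obtain ⟨i', j', h4, h5, h6, h7, h8, h9, h10⟩ := hb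
          by_contra hij
          have m1 := hF _ _ h1
          have m2 := hF _ _ h2
          have m3 := hF _ _ h8
          have hic : i ≠ r := by grind
          have hjc : j ≠ c := by grind
          have hb1 := hbot _ _ m1.1
          have hb2 := hrt _ m2.1
          have hb3 := hbot _ _ m3.1
          have hb4 := hrt _ h7
          have d1 : (i, j) ∈ S := hdn i i j c (hsub _ _ m1.1).1 (hsub _ _ m2.1).2 le_rfl hb2 m1.1
          have d2 : (i', j) ∈ S := hdn i' r j j (hsub _ _ m3.1).1 (hsub _ _ m2.1).2 hb3 le_rfl m2.1
          have d3 : (i, j') ∈ S := hdn i r j' j' (hsub _ _ m1.1).1 (hsub _ _ m3.1).2 hb1 le_rfl h7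
          have e1 := hL i i' c j
          have e2 := hL i r j' j
          have e3 := hL i' r j' j
          grind
        intro a b x y; grind
      · rw [← hu]; congr 1; apply unr_congr; intro i _; exact hbadr T hrc hFS hb i
    · rw [fX, if_neg hb]
      refine ⟨⟨⟨⟨?_, ?_⟩, ?_, ?_⟩, Or.inl ⟨?_, ?_⟩⟩, hst' T hrc⟩
      · intro a b; simp only [st_ap]; grind
      · intro a b x y; simp only [st_ap]; simp only [Bad] at hb; grind
      · intro j hj; obtain ⟨i, hi⟩ := hN j hj; refine ⟨i, ?_⟩; simp only [st_ap]; grind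
      · rw [← hu]; congr 1; apply unr_congr; intro i _; rw [rst_st h]
      · simp [st_ap]
      · obtain ⟨i, hi⟩ := hN c (hsub _ _ hmem).2
        simp only [Cz, st_ap]; grind

lemma x2 (h : Cor I J S r c) (m) :
   {T | T ∈ AA XA I J S m ∧ (T (r,c) = true ∧ Cz r c T)}.ncard
    = {T | T ∈ AA XA I (J.erase c) (Sc S c) m ∧ ¬ Rst (Sc S c) T r}.ncard := by
  obtain ⟨⟨hsub, hdn⟩, hmem, hbot, hrt⟩ := h
  have h : Cor I J S r c := ⟨⟨hsub, hdn⟩, hmem, hbot, hrt⟩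
  apply ncard_bij (zc c) (st r c true)
  · rintro T ⟨⟨⟨hF, hL⟩, hN, hu⟩, ht, hC⟩
    simp only [Cz] at hC
    simp only [Fil] at hF
    refine ⟨⟨⟨⟨?_, ?_⟩, ?_, ?_⟩, ?_⟩, ?_⟩
    · intro a b; simp only [zc_ap, mem_Sc]; grind [Fil]
    · intro a b x y; simp only [zc_ap, mem_Sc]; grind
    · intro j hj; simp only [zc_ap]; grind
    · rw [← hu]; congr 1; apply unr_congr; intro i _; symm; apply rst_c
      · intro i j hj; simp [zc_ap, hj]
      · intro i' h1 h2 h3 h4; have := hbot _ _ h2; grind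
    · rintro ⟨j, h1, h2, i, h3, h4⟩
      simp only [mem_Sc, zc_ap] at h1 h2 h4
      have m1 := hF i j (by grind)
      have := hrt _ h1.1
      have d1 : (i, c) ∈ S := hdn i r c c (hsub _ _ m1).1 (hsub _ _ hmem).2 h3.le le_rfl hmem
      have := hL i r j c d1 h1.1
      grind
    · funext ⟨a, b⟩; simp only [st_ap, zc_ap]; grind
  · rintro T ⟨⟨⟨hF, hL⟩, hN, hu⟩, hR⟩
    simp only [Fil, mem_Sc] at hF hL
    have hrc : ∀ i, T (i, c) = false := by grind
    refine ⟨⟨⟨⟨?_, ?_⟩, ?_, ?_⟩, ?_, ?_⟩, ?_⟩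
    · intro a b; simp only [st_ap]; grind
    · have hR' : ∀ i j, i ≠ r → (r, j) ∈ S → T (i, j) = true → T (r, j) = true := by
        intro i j h1 h2 h3
        by_contra h4
        have m1 := hF _ _ h3
        have := hbot _ _ m1.1
        exact hR ⟨j, mem_Sc.2 ⟨h2, m1.2⟩, by simpa using h4, i, by omega, h3⟩
      intro a b x y; simp only [st_ap]; grind
    · intro j hj; simp only [st_ap]; by_cases hjc : j = c
      · exact ⟨r, by simp [hjc]⟩
      · obtain ⟨i, hi⟩ := hN j (by grind)
        exact ⟨i, by grind⟩
    · rw [← hu]; congr 1; apply unr_congr; intro i _; apply rst_c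
      · intro i j hj; simp [st_ap, hj]
      · intro i' h1 h2 h3 h4; have := hbot _ _ h2; simp only [st_ap] at h4; grind
    · simp [st_ap]
    · simp only [Cz, st_ap]; grind
    · funext ⟨a, b⟩; simp only [st_ap, zc_ap]; grind

open Classical in
noncomputable def fR (S : Finset (ℕ × ℕ)) (r c : ℕ) (T : ℕ × ℕ → Bool) : ℕ × ℕ → Bool := fun p =>
  if p.1 = r then decide ((r, p.2) ∈ S ∧ p.2 ≠ c ∧ ∀ i, T (i, c) = true → i ≠ r → T (i, p.2) = true) else T p
lemma fR_ap {T a b} : fR S r c T (a, b) = true ↔ (a ≠ r ∧ T (a, b) = true) ∨ (a = r ∧ (r, b) ∈ S ∧ b ≠ c ∧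
    ∀ i, T (i, c) = true → i ≠ r → T (i, b) = true) := by
  simp only [fR]; split_ifs with hh <;> simp_all

open Classical in
noncomputable def fC (S : Finset (ℕ × ℕ)) (r c : ℕ) (T : ℕ × ℕ → Bool) : ℕ × ℕ → Bool := fun p =>
  if p.2 = c then decide ((p.1, c) ∈ S ∧ ∃ j, j ≠ c ∧ (r, j) ∈ S ∧ T (r, j) = false ∧ T (p.1, j) = true) else T p
lemma fC_ap {T a b} : fC S r c T (a, b) = true ↔ (b ≠ c ∧ T (a, b) = true) ∨ (b = c ∧ (a, c) ∈ S ∧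
    ∃ j, j ≠ c ∧ (r, j) ∈ S ∧ T (r, j) = false ∧ T (a, j) = true) := by
  simp only [fC]; split_ifs with hh <;> simp_all

lemma x3 (h : Cor I J S r c) (m) :
   {T | T ∈ AA XA I J S m ∧ (T (r,c) = false ∧ ¬ Bad S r c T ∧ CaA S r c T)}.ncard
    = (AA XA (I.erase r) J (Sr S r) m).ncard := by
  obtain ⟨⟨hsub, hdn⟩, hmem, hbot, hrt⟩ := h
  have h : Cor I J S r c := ⟨⟨hsub, hdn⟩, hmem, hbot, hrt⟩
  have hin : ∀ i j x, (i, x) ∈ S → (r, j) ∈ S → (i, j) ∈ S := fun i j x h1 h2 =>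
    hdn i r j j (hsub _ _ h1).1 (hsub _ _ h2).2 (hbot _ _ h1) le_rfl h2
  clear hdn
  apply ncard_bij (zr r) (fR S r c)
  · rintro T ⟨⟨⟨hF, hL⟩, hN, hu⟩, ht, hB, hA⟩
    simp only [Fil] at hF
    obtain ⟨i1, hi1⟩ := hN c (hsub _ _ hmem).2
    have hi1r : i1 ≠ r := by rintro rfl; simp_all
    have key : ∀ i j, T (i, c) = true → T (r, j) = true → T (i, j) = true := by
      intro i j h1 h2
      have := hL i r c j (hin _ _ _ (hF _ _ h1) (hF _ _ h2)) hmem h1 h2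
      simpa [ht] using this
    refine ⟨⟨⟨?_, ?_⟩, ?_, ?_⟩, ?_⟩
    · intro a b; simp only [zr_ap, mem_Sr]; grind
    · intro a b x y; simp only [zr_ap, mem_Sr]; have := hL a b x y; grind
    · intro j hj; simp only [zr_ap]
      obtain ⟨i, hi⟩ := hN j hj
      by_cases hir : i = r
      · subst hir; exact ⟨i1, by simp [hi1r, key _ _ hi1 hi]⟩
      · exact ⟨i, by simp [hir, hi]⟩
    · rw [← hu]; congr 1; symm; apply unr_erase
      · have := hbot _ _ (hF _ _ hi1)
        exact ⟨c, hmem, ht, i1, by omega, hi1⟩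
      · intro i _ hi; rw [rst_r h i hi]
    · funext ⟨a, b⟩
      rw [Bool.eq_iff_iff, fR_ap]
      by_cases har : a = r
      · subst har
        simp only [zr_ap, ne_eq, not_true, false_and, true_and, false_or]
        constructor
        · rintro ⟨h1, h2, h3⟩
          by_contra h4
          obtain ⟨i, h5, h6⟩ := hA b h2 h1 (by simpa using h4)
          have hia : i ≠ a := by rintro rfl; simp_all
          have := h3 i
          simp [hia, h5, h6] at this
        · intro h1
          refine ⟨hF _ _ h1, ?_, ?_⟩
          · rintro rfl; simp_all
          · intro i h2 h3
            simp only [h3, if_false] at h2 ⊢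
            exact key _ _ h2 h1
      · simp [zr_ap, har]
  · rintro T ⟨⟨hF, hL⟩, hN, hu⟩
    simp only [Fil, mem_Sr] at hF hL
    obtain ⟨i1, hi1⟩ := hN c (hsub _ _ hmem).2
    have hrow : ∀ j, T (r, j) = false := by
      intro j; by_contra h1; have := hF r j (by simpa using h1); simp at this
    have hzr : zr r (fR S r c T) = T := by
      funext ⟨a, b⟩
      simp only [zr_ap]
      split_ifs with h1
      · rw [h1, hrow]
      · simp [fR, h1]
    have hoff : ∀ a b, a ≠ r → fR S r c T (a, b) = T (a, b) := by
      intro a b h1; simp [fR, h1]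
    have hon : ∀ b, fR S r c T (r, b) = true ↔ (r, b) ∈ S ∧ b ≠ c ∧ ∀ i, T (i, c) = true → T (i, b) = true := by
      intro b; rw [fR_ap]
      constructor
      · rintro (⟨h1, _⟩ | ⟨_, h1, h2, h3⟩)
        · exact absurd rfl h1
        · exact ⟨h1, h2, fun i hi => h3 i hi (hF _ _ hi).2⟩
      · rintro ⟨h1, h2, h3⟩; exact Or.inr ⟨rfl, h1, h2, fun i hi _ => h3 i hi⟩
    have hrc : fR S r c T (r, c) = false := by
      by_contra h1
      exact ((hon c).1 (by simpa using h1)).2.1 rfl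
    have key : ∀ b x y, b ≠ r → fR S r c T (r, x) = true → T (b, y) = true → (r, y) ∈ S →
        fR S r c T (r, y) = true ∨ T (b, x) = true := by
      intro b x y hb h1 h2 h3
      rw [hon] at h1
      obtain ⟨h4, h5, h6⟩ := h1
      by_cases hbx : T (b, c) = true
      · exact Or.inr (h6 b hbx)
      · left
        rw [hon]
        refine ⟨h3, ?_, ?_⟩
        · rintro rfl; exact hbx h2
        · intro i hi
          have m1 := hF _ _ hi
          have m2 := hF _ _ h2
          have := hL i b c y ⟨hin _ _ _ m1.1 h3, m1.2⟩ ⟨hin _ _ _ m2.1 hmem, m2.2⟩ hi h2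
          simpa [hbx] using this
    refine ⟨⟨⟨⟨?_, ?_⟩, ?_, ?_⟩, hrc, ?_, ?_⟩, hzr⟩
    · intro a b h1
      rw [fR_ap] at h1
      rcases h1 with h1 | h1
      · exact (hF _ _ h1.2).1
      · rw [h1.1]; exact h1.2.1
    · intro a b x y h1 h2 h3 h4
      by_cases ha : a = r
      · by_cases hb : b = r
        · subst ha; subst hb; exact Or.inr h3
        · rw [ha] at h1 h3 ⊢
          rw [hoff _ _ hb] at h4 ⊢
          exact key b x y hb h3 h4 h1
      · by_cases hb : b = r
        · rw [hb] at h2 h4 ⊢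
          rw [hoff _ _ ha] at h3 ⊢
          exact (key a y x ha h4 h3 h2).symm
        · rw [hoff _ _ ha] at h3 ⊢
          rw [hoff _ _ hb] at h4 ⊢
          exact hL a b x y ⟨h1, ha⟩ ⟨h2, hb⟩ h3 h4
    · intro j hj; obtain ⟨i, hi⟩ := hN j hj
      exact ⟨i, by rw [hoff _ _ (hF _ _ hi).2]; exact hi⟩
    · rw [← hu]; congr 1; apply unr_erase
      · have m1 := hF _ _ hi1
        have := hbot _ _ m1.1
        exact ⟨c, hmem, hrc, i1, by omega, by rw [hoff _ _ m1.2]; exact hi1⟩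
      · intro i _ hi; rw [← rst_r h i hi, hzr]
    · rintro ⟨i, j, h4, h5, h6, h7, h8, h9, h10⟩
      rw [hoff _ _ h4] at h8 h9
      have h11 : ¬ (fR S r c T (r, j) = true) := by simp [h10]
      rw [hon] at h11
      apply h11
      refine ⟨h7, h5, ?_⟩
      intro i' hi'
      have m1 := hF _ _ hi'
      have := hL i i' j c ⟨h6, h4⟩ ⟨hin _ _ _ m1.1 h7, m1.2⟩ h8 hi'
      simpa [h9] using this
    · intro j h1 h2 h3
      have h11 : ¬ (fR S r c T (r, j) = true) := by simp [h3]
      rw [hon] at h11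
      push Not at h11
      obtain ⟨i, hi, hi2⟩ := h11 h2 h1
      have m1 := hF _ _ hi
      exact ⟨i, by rw [hoff _ _ m1.2]; exact hi, by rw [hoff _ _ m1.2]; simpa using hi2⟩

lemma x4 (h : Cor I J S r c) (m) :
   {T | T ∈ AA XA I J S m ∧ (T (r,c) = false ∧ ¬ Bad S r c T ∧ ¬ CaA S r c T)}.ncard
    = {T | T ∈ AA XA I (J.erase c) (Sc S c) m ∧ Rst (Sc S c) T r}.ncard := by
  obtain ⟨⟨hsub, hdn⟩, hmem, hbot, hrt⟩ := h
  have h : Cor I J S r c := ⟨⟨hsub, hdn⟩, hmem, hbot, hrt⟩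
  have hin : ∀ i j x, (i, x) ∈ S → (r, j) ∈ S → (i, j) ∈ S := fun i j x h1 h2 =>
    hdn i r j j (hsub _ _ h1).1 (hsub _ _ h2).2 (hbot _ _ h1) le_rfl h2
  clear hdn
  apply ncard_bij (zc c) (fC S r c)
  · rintro T ⟨⟨⟨hF, hL⟩, hN, hu⟩, ht, hB, hA⟩
    simp only [Fil] at hF
    obtain ⟨i1, hi1⟩ := hN c (hsub _ _ hmem).2
    have hi1r : i1 ≠ r := by rintro rfl; simp_all
    have hi1b := hbot _ _ (hF _ _ hi1)
    have hB' : ∀ i j, j ≠ c → (r, j) ∈ S → T (r, j) = false → T (i, j) = true → T (i, c) = true := by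
      intro i j h1 h2 h3 h4
      by_contra h5
      refine hB ⟨i, j, ?_, h1, hin _ _ _ (hF _ _ h4) hmem, h2, h4, by simpa using h5, h3⟩
      rintro rfl; simp_all
    simp only [CaA] at hA
    push Not at hA
    obtain ⟨j1, hj1, hj1S, hj1r, hj1C⟩ := hA
    have hzc : ∀ i j, j ≠ c → zc c T (i, j) = T (i, j) := by intro i j hj; simp [zc_ap, hj]
    refine ⟨⟨⟨⟨?_, ?_⟩, ?_, ?_⟩, ?_⟩, ?_⟩
    · intro a b; simp only [zc_ap, mem_Sc]; grind
    · intro a b x y; simp only [zc_ap, mem_Sc]; have := hL a b x y; grind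
    · intro j hj
      obtain ⟨hj1, hj2⟩ := Finset.mem_erase.1 hj
      obtain ⟨i, hi⟩ := hN j hj2
      exact ⟨i, by rw [hzc _ _ hj1]; exact hi⟩
    · rw [← hu]; congr 1; apply unr_congr; intro i _; symm; apply rst_c hzc
      intro i' h1 h2 h3 h4
      refine ⟨j1, mem_Sc.2 ⟨hin _ _ _ h2 hj1S, hj1⟩, ?_, i', h1, ?_⟩
      · rw [hzc _ _ hj1]; by_contra h5
        have := hB' i j1 hj1 hj1S hj1r (by simpa using h5)
        simp [this] at h3
      · rw [hzc _ _ hj1]; simpa using hj1C i' h4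
    · refine ⟨j1, mem_Sc.2 ⟨hj1S, hj1⟩, by rw [hzc _ _ hj1]; exact hj1r, i1, by omega, ?_⟩
      rw [hzc _ _ hj1]; simpa using hj1C i1 hi1
    · funext ⟨a, b⟩
      rw [Bool.eq_iff_iff, fC_ap]
      by_cases hb : b = c
      · subst hb
        constructor
        · rintro (⟨h1, _⟩ | ⟨_, h1, j, h2, h3, h4, h5⟩)
          · exact absurd rfl h1
          · rw [hzc _ _ h2] at h4 h5
            exact hB' a j h2 h3 h4 h5
        · intro h1
          exact Or.inr ⟨rfl, hF _ _ h1, j1, hj1, hj1S, by rw [hzc _ _ hj1]; exact hj1r,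
            by rw [hzc _ _ hj1]; simpa using hj1C a h1⟩
      · simp [zc_ap, hb]
  · rintro T ⟨⟨⟨hF, hL⟩, hN, hu⟩, hR⟩
    simp only [Fil, mem_Sc] at hF hL
    have hcol : ∀ i, T (i, c) = false := by
      intro i; by_contra h1; have := hF i c (by simpa using h1); simp at this
    have hoff : ∀ a b, b ≠ c → fC S r c T (a, b) = T (a, b) := by
      intro a b h1; simp [fC, h1]
    have hon : ∀ a, fC S r c T (a, c) = true ↔ 
        ∃ j, j ≠ c ∧ (r, j) ∈ S ∧ T (r, j) = false ∧ T (a, j) = true := by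
      intro a; rw [fC_ap]
      constructor
      · rintro (⟨h1, _⟩ | ⟨_, _, h1⟩)
        · exact absurd rfl h1
        · exact h1
      · rintro ⟨j, h1, h2, h3, h4⟩
        exact Or.inr ⟨rfl, hin _ _ _ (hF _ _ h4).1 hmem, j, h1, h2, h3, h4⟩
    have hrc : fC S r c T (r, c) = false := by
      by_contra h1
      obtain ⟨j, _, _, h2, h3⟩ := (hon r).1 (by simpa using h1)
      simp [h2] at h3
    have key : ∀ a b y, y ≠ c → fC S r c T (a, c) = true → T (b, y) = true → (a, y) ∈ S →
        T (a, y) = true ∨ fC S r c T (b, c) = true := by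
      intro a b y hy h1 h2 h3
      rw [hon] at h1 ⊢
      obtain ⟨j, h4, h5, h6, h7⟩ := h1
      rcases hL a b j y ⟨h3, hy⟩ ⟨hin _ _ _ (hF _ _ h2).1 h5, h4⟩ h7 h2 with h8 | h8
      · exact Or.inl h8
      · exact Or.inr ⟨j, h4, h5, h6, h8⟩
    refine ⟨⟨⟨⟨?_, ?_⟩, ?_, ?_⟩, hrc, ?_, ?_⟩, ?_⟩
    · intro a b h1
      rw [fC_ap] at h1
      rcases h1 with h1 | h1
      · exact (hF _ _ h1.2).1
      · rw [h1.1]; exact h1.2.1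
    · intro a b x y h1 h2 h3 h4
      by_cases hx : x = c
      · by_cases hy : y = c
        · subst hx; subst hy; exact Or.inl h3
        · rw [hx] at h2 h3 ⊢
          rw [hoff _ _ hy] at h4 ⊢
          exact key a b y hy h3 h4 h1
      · by_cases hy : y = c
        · rw [hy] at h1 h4 ⊢
          rw [hoff _ _ hx] at h3 ⊢
          exact (key b a x hx h4 h3 h2).symm
        · rw [hoff _ _ hx] at h3 ⊢
          rw [hoff _ _ hy] at h4 ⊢
          exact hL a b x y ⟨h1, hy⟩ ⟨h2, hx⟩ h3 h4
    · intro j hj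
      by_cases hjc : j = c
      · obtain ⟨j1, h1, h2, i, _, h3⟩ := hR
        obtain ⟨h1, h4⟩ := mem_Sc.1 h1
        exact ⟨i, by rw [hjc, hon]; exact ⟨j1, h4, h1, h2, h3⟩⟩
      · obtain ⟨i, hi⟩ := hN j (Finset.mem_erase.2 ⟨hjc, hj⟩)
        exact ⟨i, by rw [hoff _ _ hjc]; exact hi⟩
    · rw [← hu]; congr 1; apply unr_congr; intro i _
      apply rst_c (fun i j hj => (hoff i j hj).symm)
      intro i' h1 h2 h3 h4
      obtain ⟨j, h5, h6, h7, h8⟩ := (hon i').1 h4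
      refine ⟨j, mem_Sc.2 ⟨hin _ _ _ h2 h6, h5⟩, ?_, i', h1, h8⟩
      by_contra h9
      have := (hon i).2 ⟨j, h5, h6, h7, by simpa using h9⟩
      simp [this] at h3
    · rintro ⟨i, j, h4, h5, h6, h7, h8, h9, h10⟩
      rw [hoff _ _ h5] at h8 h10
      have := (hon i).2 ⟨j, h5, h7, h10, h8⟩
      simp [this] at h9
    · intro hA
      let K := J.filter (fun j => j ≠ c ∧ (r, j) ∈ S ∧ T (r, j) = false)
      have hK : K.Nonempty := by
        obtain ⟨j1, h1, h2, _⟩ := hR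
        obtain ⟨h1, h4⟩ := mem_Sc.1 h1
        exact ⟨j1, Finset.mem_filter.2 ⟨(hsub _ _ h1).2, h4, h1, h2⟩⟩
      obtain ⟨j, hj, hmax⟩ := Finset.exists_max_image K
        (fun j => (I.filter (fun i => T (i, j) = true)).card) hK
      obtain ⟨_, h1, h2, h3⟩ := Finset.mem_filter.1 hj
      obtain ⟨i, h4, h5⟩ := hA j h1 h2 (by rw [hoff _ _ h1]; exact h3)
      rw [hoff _ _ h1] at h5
      obtain ⟨j2, h6, h7, h8, h9⟩ := (hon i).1 h4
      have hle := hmax j2 (Finset.mem_filter.2 ⟨(hsub _ _ h7).2, h6, h7, h8⟩)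
      have hlt : (I.filter (fun i => T (i, j) = true)).card < (I.filter (fun i => T (i, j2) = true)).card := by
        apply Finset.card_lt_card
        rw [Finset.ssubset_iff_of_subset]
        · exact ⟨i, Finset.mem_filter.2 ⟨(hsub _ _ (hF _ _ h9).1).1, h9⟩, by simp [h5]⟩
        · intro b hb
          obtain ⟨hb1, hb2⟩ := Finset.mem_filter.1 hb
          refine Finset.mem_filter.2 ⟨hb1, ?_⟩
          have := hL i b j2 j ⟨hin _ _ _ (hF _ _ h9).1 h2, h1⟩ ⟨hin _ _ _ (hF _ _ hb2).1 h7, h6⟩ h9 hb2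
          simpa [h5] using this
      exact absurd hle (not_le.2 hlt)
    · funext ⟨a, b⟩
      simp only [zc_ap]
      split_ifs with h1
      · rw [h1, hcol]
      · exact hoff _ _ h1

lemma x_rec (h : Cor I J S r c) (m) : (AA XA I J S m).ncard =
    (AA XA I J (Se S r c) m).ncard + (AA XA I (J.erase c) (Sc S c) m).ncard
      + (AA XA (I.erase r) J (Sr S r) m).ncard := by
  have hfin := AA_finite XA_fil I J S m
  have hfin2 := AA_finite XA_fil I (J.erase c) (Sc S c) m
  rw [ncard_split hfin2 (fun T => Rst (Sc S c) T r), ← x1 h, ← x2 h, ← x3 h, ← x4 h]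
  rw [ncard_split hfin (fun T => (T (r,c) = true ∧ ¬ Cz r c T) ∨ (T (r, c) = false ∧ Bad S r c T))]
  rw [ncard_split (hfin.subset (t := {T | T ∈ AA XA I J S m ∧ ¬ ((T (r,c) = true ∧ ¬ Cz r c T) ∨ (T (r, c) = false ∧ Bad S r c T))})
    (fun T hT => hT.1)) (fun T => T (r,c) = true)]
  rw [ncard_split ((hfin.subset (t := {T | T ∈ {T | T ∈ AA XA I J S m ∧ ¬ ((T (r,c) = true ∧ ¬ Cz r c T) ∨ (T (r, c) = false ∧ Bad S r c T))} ∧ ¬ (T (r, c) = true)})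
    (fun T hT => hT.1.1))) (fun T => CaA S r c T)]
  have e1 : {T | T ∈ {T | T ∈ AA XA I J S m ∧ ¬ ((T (r,c) = true ∧ ¬ Cz r c T) ∨ (T (r, c) = false ∧ Bad S r c T))} ∧ T (r, c) = true}
      = {T | T ∈ AA XA I J S m ∧ (T (r,c) = true ∧ Cz r c T)} := by
    ext T; simp only [Set.mem_ofPred_eq]; cases T (r, c) <;> simp
  have e2 : {T | T ∈ {T | T ∈ {T | T ∈ AA XA I J S m ∧ ¬ ((T (r,c) = true ∧ ¬ Cz r c T) ∨ (T (r, c) = false ∧ Bad S r c T))} ∧ ¬ (T (r, c) = true)} ∧ CaA S r c T}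
      = {T | T ∈ AA XA I J S m ∧ (T (r,c) = false ∧ ¬ Bad S r c T ∧ CaA S r c T)} := by
    ext T; simp only [Set.mem_ofPred_eq]; cases T (r, c) <;> simp [and_assoc]
  have e3 : {T | T ∈ {T | T ∈ {T | T ∈ AA XA I J S m ∧ ¬ ((T (r,c) = true ∧ ¬ Cz r c T) ∨ (T (r, c) = false ∧ Bad S r c T))} ∧ ¬ (T (r, c) = true)} ∧ ¬ CaA S r c T}
      = {T | T ∈ AA XA I J S m ∧ (T (r,c) = false ∧ ¬ Bad S r c T ∧ ¬ CaA S r c T)} := by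
    ext T; simp only [Set.mem_ofPred_eq]; cases T (r, c) <;> simp [and_assoc]
  rw [e1, e2, e3]
  ring
end

theorem main_eq (n : ℕ) : ∀ (I J : Finset ℕ) (S : Finset (ℕ × ℕ)), S.card = n → Shp I J S → ∀ m,
    (AA XA I J S m).ncard = (AA LA I J S m).ncard := by
  induction n using Nat.strong_induction_on with
  | _ n ih =>
  intro I J S hn hS m
  by_cases hne : S = ∅
  · subst hne
    congr 1
    ext T
    have : XA ∅ T ↔ LA ∅ T := by simp [XA, LA]
    simp only [AA, Set.mem_ofPred_eq, this]
  · obtain ⟨⟨r, c0⟩, hr, hrmax⟩ := Finset.exists_max_image S Prod.fst (Finset.nonempty_of_ne_empty hne)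
    obtain ⟨⟨r', c⟩, hc, hcmax⟩ := Finset.exists_max_image (S.filter (fun p => p.1 = r)) Prod.snd
      ⟨(r, c0), by simp [hr]⟩
    obtain ⟨hc1, hc2⟩ := Finset.mem_filter.1 hc
    simp only at hc2
    subst hc2
    have hcor : Cor I J S r' c := ⟨hS, hc1, fun i j h => hrmax (i, j) h,
      fun j h => hcmax (r', j) (by simp [h])⟩
    obtain ⟨⟨hsub, hdn⟩, hmem, hbot, hrt⟩ := hcor
    have hcor : Cor I J S r' c := ⟨hS, hmem, hbot, hrt⟩
    rw [x_rec hcor, le_rec hcor]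
    have lt1 : (Se S r' c).card < n := by
      rw [← hn]; apply Finset.card_lt_card
      exact Finset.filter_ssubset.2 ⟨(r', c), hmem, by simp⟩
    have lt2 : (Sc S c).card < n := by
      rw [← hn]; apply Finset.card_lt_card
      exact Finset.filter_ssubset.2 ⟨(r', c), hmem, by simp⟩
    have lt3 : (Sr S r').card < n := by
      rw [← hn]; apply Finset.card_lt_card
      exact Finset.filter_ssubset.2 ⟨(r', c), hmem, by simp⟩
    rw [ih _ lt1 I J _ rfl, ih _ lt2 I (J.erase c) _ rfl, ih _ lt3 (I.erase r') J _ rfl]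
    · constructor
      · intro i j h; rw [mem_Sr] at h; have := hsub _ _ h.1
        exact ⟨Finset.mem_erase.2 ⟨h.2, this.1⟩, this.2⟩
      · intro i i' j j' h1 h2 h3 h4 h5
        rw [mem_Sr] at h5 ⊢
        rw [Finset.mem_erase] at h1
        exact ⟨hdn _ _ _ _ h1.2 h2 h3 h4 h5.1, h1.1⟩
    · constructor
      · intro i j h; rw [mem_Sc] at h; have := hsub _ _ h.1
        exact ⟨this.1, Finset.mem_erase.2 ⟨h.2, this.2⟩⟩
      · intro i i' j j' h1 h2 h3 h4 h5
        rw [mem_Sc] at h5 ⊢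
        rw [Finset.mem_erase] at h2
        exact ⟨hdn _ _ _ _ h1 h2.2 h3 h4 h5.1, h2.1⟩
    · constructor
      · intro i j h; rw [mem_Se] at h; exact hsub _ _ h.1
      · intro i i' j j' h1 h2 h3 h4 h5
        rw [mem_Se] at h5 ⊢
        refine ⟨hdn _ _ _ _ h1 h2 h3 h4 h5.1, ?_⟩
        rintro ⟨rfl, rfl⟩
        have e1 : i' = i := le_antisymm (hbot _ _ h5.1) h3
        subst e1
        exact h5.2 ⟨rfl, le_antisymm (hrt _ h5.1) h4⟩

lemma link_fil (S : Finset (ℕ × ℕ)) (T) : IsFilling S T ↔ Fil S T := by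
  constructor
  · intro h a b hab; by_contra h1; rw [h _ h1] at hab; simp at hab
  · rintro h ⟨a, b⟩ hab; by_contra h1; exact hab (h a b (by simpa using h1))

lemma link_X (S : Finset (ℕ × ℕ)) (T) : IsXDiagram S T ↔ XA S T := by
  unfold IsXDiagram XA
  rw [link_fil]
  refine and_congr_right fun hF => ?_
  constructor
  · rintro ⟨h1, h2⟩ a b c d had hbc hac hbd
    by_contra hcon
    rw [not_or] at hcon
    obtain ⟨g1, g2⟩ := hcon
    have mac := hF _ _ hac
    have mbd := hF _ _ hbd
    have g1' : T (a, d) = false := by simpa using g1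
    have g2' : T (b, c) = false := by simpa using g2
    have hab : a ≠ b := by rintro rfl; exact g1 hbd
    have hcd : c ≠ d := by rintro rfl; exact g1 hac
    rcases lt_or_gt_of_ne hab with hab | hab <;> rcases lt_or_gt_of_ne hcd with hcd | hcd
    · exact h1 ⟨a, b, c, d, hab, hcd, mac, had, hbc, mbd, hac, g1', g2', hbd⟩
    · exact h2 ⟨a, b, d, c, hab, hcd, had, mac, mbd, hbc, g1', hac, hbd, g2'⟩
    · exact h2 ⟨b, a, c, d, hab, hcd, hbc, mbd, mac, had, g2', hbd, hac, g1'⟩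
    · exact h1 ⟨b, a, d, c, hab, hcd, mbd, hbc, had, mac, hbd, g2', g1', hac⟩
  · intro h
    constructor
    · rintro ⟨i, i', j, j', _, _, m1, m2, m3, m4, t1, t2, t3, t4⟩
      have := h i i' j j' m2 m3 t1 t4
      simp [t2, t3] at this
    · rintro ⟨i, i', j, j', _, _, m1, m2, m3, m4, t1, t2, t3, t4⟩
      have := h i i' j' j m1 m4 t2 t3
      simp [t1, t4] at this

lemma link_L (μ : YoungDiagram) (T) : IsLeDiagram μ.cells T ↔ LA μ.cells T := by
  unfold IsLeDiagram LA
  rw [link_fil]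
  refine and_congr_right fun hF => ?_
  constructor
  · rintro ⟨h1, h2⟩ a b c d hab hcd hbd had hbc
    by_contra g1
    have g1' : T (b, d) = false := by simpa using g1
    have mad := hF _ _ had
    have mbc := hF _ _ hbc
    have mac : (a, c) ∈ μ.cells := μ.isLowerSet (show (a, c) ≤ (a, d) from ⟨le_rfl, hcd.le⟩) mad
    cases hac : T (a, c)
    · exact h2 ⟨a, b, c, d, hab, hcd, mac, mad, mbc, hbd, hac, had, hbc, g1'⟩
    · exact h1 ⟨a, b, c, d, hab, hcd, mac, mad, mbc, hbd, hac, had, hbc, g1'⟩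
  · intro h
    constructor <;>
    · rintro ⟨i, i', j, j', hi, hj, m1, m2, m3, m4, t1, t2, t3, t4⟩
      have := h i i' j j' hi hj m4 t2 t3
      simp [t4] at this

lemma link_R (S : Finset (ℕ × ℕ)) (T) (hF : Fil S T) (i) : RestrictedRow S T i ↔ Rst S T i := by
  constructor
  · rintro ⟨j, h1, h2, i', h3, _, h4⟩; exact ⟨j, h1, h2, i', h3, h4⟩
  · rintro ⟨j, h1, h2, i', h3, h4⟩; exact ⟨j, h1, h2, i', h3, hF _ _ h4, h4⟩

lemma link_set {P Q : Finset (ℕ × ℕ) → (ℕ × ℕ → Bool) → Prop} (S : Finset (ℕ × ℕ)) (hQ : ∀ S T, Q S T → Fil S T)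
    (hPQ : ∀ T, P S T ↔ Q S T) (m : ℕ) :
    {T : ℕ × ℕ → Bool | P S T ∧ NoZeroCol S T ∧
        {i | (∃ j, (i, j) ∈ S) ∧ ¬ RestrictedRow S T i}.ncard = m} =
      AA Q (S.image Prod.fst) (S.image Prod.snd) S m := by
  ext T
  simp only [AA, Set.mem_ofPred_eq, hPQ]
  refine and_congr_right fun hT => ?_
  have hF := hQ _ _ hT
  have e1 : NoZeroCol S T ↔ ∀ j ∈ S.image Prod.snd, ∃ i, T (i, j) = true := by
    constructor
    · intro h j hj
      obtain ⟨⟨i, j'⟩, h1, h2⟩ := Finset.mem_image.1 hj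
      simp only at h2; subst h2
      have h3 := h j' ⟨i, h1⟩
      unfold ZeroCol at h3
      push Not at h3
      obtain ⟨i', _, h4⟩ := h3
      exact ⟨i', by simpa using h4⟩
    · rintro h j ⟨i, hi⟩ hz
      obtain ⟨i', hi'⟩ := h j (Finset.mem_image.2 ⟨(i, j), hi, rfl⟩)
      have := hz i' (hF _ _ hi')
      simp [hi'] at this
  have e2 : {i | (∃ j, (i, j) ∈ S) ∧ ¬ RestrictedRow S T i} = (unr (S.image Prod.fst) S T : Set ℕ) := by
    ext i
    simp only [unr, Set.mem_ofPred_eq, Finset.coe_filter, link_R S T hF, Finset.mem_image,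
      Prod.exists, exists_and_right, exists_eq_right]
  rw [e1, e2, Set.ncard_coe_finset]

/-- the number of X-diagrams of shape `μ` with no zero-column and
exactly `m` unrestricted rows equals the number of permutation tableaux
(Le-diagrams with no zero-column) of shape `μ` with exactly `m` unrestricted
rows. -/
theorem stmt9 (μ : YoungDiagram) (m : ℕ) :
    {T : ℕ × ℕ → Bool | IsXDiagram μ.cells T ∧ NoZeroCol μ.cells T ∧
        {i | (∃ j, (i, j) ∈ μ.cells) ∧ ¬ RestrictedRow μ.cells T i}.ncard = m}.ncard
  = {T : ℕ × ℕ → Bool | IsLeDiagram μ.cells T ∧ NoZeroCol μ.cells T ∧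
        {i | (∃ j, (i, j) ∈ μ.cells) ∧ ¬ RestrictedRow μ.cells T i}.ncard = m}.ncard := by
  rw [link_set (P := IsXDiagram) (Q := XA) μ.cells XA_fil (link_X μ.cells) m,
    link_set (P := IsLeDiagram) (Q := LA) μ.cells LA_fil (link_L μ) m]
  apply main_eq _ _ _ _ rfl
  constructor
  · intro i j h
    exact ⟨Finset.mem_image.2 ⟨(i, j), h, rfl⟩, Finset.mem_image.2 ⟨(i, j), h, rfl⟩⟩
  · intro i i' j j' _ _ h1 h2 h3
    exact μ.isLowerSet (show (i, j) ≤ (i', j') from ⟨h1, h2⟩) h3
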